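/- arXiv:2211.13671 — 8 statements merged into one kernel-verified Lean document; each statement's English description precedes it below -/
import Mathlib

section
/- Fix k₁, k₀, u₁, u₀ ∈ ℂ∖{0} and a square root q^{1/2} ∈ ℂ∖{0} of q. Define c₁(x) := k₁⁻¹(1 − k₁u₁x)(1 + k₁u₁⁻¹x)/(1 − x²) and c₀(x) := k₀⁻¹(1 − k₀u₀q^{1/2}x⁻¹)(1 + k₀u₀⁻¹q^{1/2}x⁻¹)/(1 − qx⁻²). For g : ℂ∖{0} → ℂ define (T₁g)(x) := k₁g(x) + c₁(x)(g(x⁻¹) − g(x)), (T₀g)(x) := k₀g(x) + c₀(x)(g(qx⁻¹) − g(x)), (T₁⁻g)(x) := k₁⁻¹g(x) + c₁(x)(g(x⁻¹) − g(x)), (T₀⁻g)(x) := k₀⁻¹g(x) + c₀(x)(g(qx⁻¹) − g(x)). Then for every f : ℂ∖{0} → ℂ with f(x⁻¹) = f(x) for all x, and every x ∈ ℂ∖{0} with x² ∉ {1, q, q⁻¹, q²}, one has (T₀(T₁f))(x) + (T₁⁻(T₀⁻f))(x) = (k₁k₀ + (k₁k₀)⁻¹) f(x) + (k₁k₀)⁻¹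 [ A⁺(x)(f(qx) − f(x)) + A⁺(x⁻¹)(f(q⁻¹x) − f(x)) ], where A⁺(x) := ((1 − ax)(1 − bx)(1 − cx)(1 − dx))/((1 − x²)(1 − qx²)) with (a,b,c,d) = (k₁u₁, −k₁u₁⁻¹, q^{1/2}k₀u₀, −q^{1/2}k₀u₀⁻¹). -/
/-- The c-function attached to the node `1` of type `(C₁^∨,C₁)`. -/
noncomputable def cOne (k1 u1 x : ℂ) : ℂ :=
  k1⁻¹ * (1 - k1 * u1 * x) * (1 + k1 * u1⁻¹ * x) / (1 - x ^ 2)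

/-- The c-function attached to the node `0` of type `(C₁^∨,C₁)`; `ν = q^{1/2}`. -/
noncomputable def cZero (k0 u0 ν x : ℂ) : ℂ :=
  k0⁻¹ * (1 - k0 * u0 * ν * x⁻¹) * (1 + k0 * u0⁻¹ * ν * x⁻¹) / (1 - ν ^ 2 * (x⁻¹) ^ 2)

/-- Action of `T₁` in Noumi's basic representation. -/
noncomputable def T1op (k1 u1 : ℂ) (g : ℂ → ℂ) (x : ℂ) : ℂ :=
  k1 * g x + cOne k1 u1 x * (g x⁻¹ - g x)

/-- Action of `T₀` in Noumi's basic representation; `ν = q^{1/2}`. -/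
noncomputable def T0op (k0 u0 ν : ℂ) (g : ℂ → ℂ) (x : ℂ) : ℂ :=
  k0 * g x + cZero k0 u0 ν x * (g (ν ^ 2 * x⁻¹) - g x)

/-- Action of the Hecke inverse `T₁⁻¹ = T₁ - k₁ + k₁⁻¹`. -/
noncomputable def T1inv (k1 u1 : ℂ) (g : ℂ → ℂ) (x : ℂ) : ℂ :=
  k1⁻¹ * g x + cOne k1 u1 x * (g x⁻¹ - g x)

/-- Action of the Hecke inverse `T₀⁻¹ = T₀ - k₀ + k₀⁻¹`. -/
noncomputable def T0inv (k0 u0 ν : ℂ) (g : ℂ → ℂ) (x : ℂ) : ℂ :=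
  k0⁻¹ * g x + cZero k0 u0 ν x * (g (ν ^ 2 * x⁻¹) - g x)

/-- The Askey–Wilson coefficient `A⁺(x)`. -/
noncomputable def Aplus (a b c d q x : ℂ) : ℂ :=
  ((1 - a * x) * (1 - b * x) * (1 - c * x) * (1 - d * x)) / ((1 - x ^ 2) * (1 - q * x ^ 2))

/-- The two values of the c-function at `x` and `x⁻¹` add up to `k₁ + k₁⁻¹`. -/
theorem cOne_add_cOne_inv {k1 u1 x : ℂ} (hk1 : k1 ≠ 0) (hu1 : u1 ≠ 0) (hx : x ≠ 0)
    (h1 : x ^ 2 ≠ 1) : cOne k1 u1 x + cOne k1 u1 x⁻¹ = k1 + k1⁻¹ := by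
  have hd : 1 - x ^ 2 ≠ 0 := sub_ne_zero.mpr h1.symm
  have hd' : x ^ 2 - 1 ≠ 0 := sub_ne_zero.mpr h1
  have e : cOne k1 u1 x⁻¹ =
      -(k1⁻¹ * (x - k1 * u1) * (x + k1 * u1⁻¹) / (1 - x ^ 2)) := by
    unfold cOne
    have h : 1 - x⁻¹ ^ 2 = -(1 - x ^ 2) / x ^ 2 := by
      field_simp
      ring
    rw [h]
    field_simp
  rw [e]
  unfold cOne
  field_simp
  ring

/-- The Askey–Wilson coefficient factors through the two c-functions. -/
theorem cOne_mul_cZero_inv (k1 k0 u1 u0 ν x : ℂ) :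
    cOne k1 u1 x * cZero k0 u0 ν x⁻¹ = (k1 * k0)⁻¹ *
      Aplus (k1 * u1) (-(k1 * u1⁻¹)) (ν * k0 * u0) (-(ν * k0 * u0⁻¹)) (ν ^ 2) x := by
  unfold cOne cZero Aplus
  rw [inv_inv, div_mul_div_comm, mul_div_assoc', mul_inv]
  congr 1
  ring

/-- `T₁` acts on inversion-invariant functions as multiplication by `k₁`. -/
theorem T1op_of_inv_eq {k1 u1 x : ℂ} {f : ℂ → ℂ} (h : f x⁻¹ = f x) :
    T1op k1 u1 f x = k1 * f x := by
  simp [T1op, h]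

/-- On inversion-invariant functions, `Y + Y⁻¹ = T₀T₁ + T₁⁻¹T₀⁻¹` acts as the
Askey–Wilson `q`-difference operator with parameters
`(a,b,c,d) = (k₁u₁, -k₁u₁⁻¹, q^{1/2}k₀u₀, -q^{1/2}k₀u₀⁻¹)`,
up to the constant `k₁k₀ + (k₁k₀)⁻¹` and the factor `(k₁k₀)⁻¹`. -/
theorem stmt_1 (k1 k0 u1 u0 ν : ℂ) (hk1 : k1 ≠ 0) (hk0 : k0 ≠ 0)
    (hu1 : u1 ≠ 0) (hu0 : u0 ≠ 0) (hν : ν ≠ 0)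
    (f : ℂ → ℂ) (hf : ∀ x : ℂ, x ≠ 0 → f x⁻¹ = f x)
    (x : ℂ) (hx : x ≠ 0) (h1 : x ^ 2 ≠ 1) (h2 : x ^ 2 ≠ ν ^ 2)
    (h3 : x ^ 2 ≠ (ν ^ 2)⁻¹) (h4 : x ^ 2 ≠ (ν ^ 2) ^ 2) :
    T0op k0 u0 ν (T1op k1 u1 f) x + T1inv k1 u1 (T0inv k0 u0 ν f) x
      = (k1 * k0 + (k1 * k0)⁻¹) * f x
        + (k1 * k0)⁻¹ *
          (Aplus (k1 * u1) (-(k1 * u1⁻¹)) (ν * k0 * u0) (-(ν * k0 * u0⁻¹)) (ν ^ 2) x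
              * (f (ν ^ 2 * x) - f x)
            + Aplus (k1 * u1) (-(k1 * u1⁻¹)) (ν * k0 * u0) (-(ν * k0 * u0⁻¹)) (ν ^ 2) x⁻¹
              * (f ((ν ^ 2)⁻¹ * x) - f x)) := by
  have hq : ν ^ 2 * x⁻¹ ≠ 0 := mul_ne_zero (pow_ne_zero 2 hν) (inv_ne_zero hx)
  have hfq : f (ν ^ 2 * x⁻¹) = f ((ν ^ 2)⁻¹ * x) := by
    rw [← hf _ hq, mul_inv, inv_inv]
  have hA := cOne_mul_cZero_inv k1 k0 u1 u0 ν x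
  have hB := cOne_mul_cZero_inv k1 k0 u1 u0 ν x⁻¹
  have hC := cOne_add_cOne_inv hk1 hu1 hx h1
  rw [inv_inv] at hB
  rw [mul_add, ← mul_assoc, ← mul_assoc, ← hA, ← hB]
  simp only [T0op, T1inv, T0inv, T1op_of_inv_eq (hf x hx), T1op_of_inv_eq (hf _ hq),
    inv_inv, hf x hx, hfq, mul_inv]
  linear_combination
    -(cZero k0 u0 ν x * (f ((ν ^ 2)⁻¹ * x) - f x)) * hC
end

section
/- Fix k ∈ ℂ∖{0} and a square root q^{1/2} ∈ ℂ∖{0} of q. Let A⁺(x) := ((1 − kx)(1 + kx)(1 − q^{1/2}x)(1 + q^{1/2}x))/((1 − x²)(1 − qx²)) be the Askey–Wilson coefficient with parameters (a,b,c,d) = (k, −k, q^{1/2}, −q^{1/2}). Then for every function f : ℂ∖{0} → ℂ and every x ∈ ℂ∖{0} with x² ∉ {1, q, q⁻¹}: k + k⁻¹ + k⁻¹[ A⁺(x)(f(qx) − f(x)) + A⁺(x⁻¹)(f(q⁻¹x) − f(x)) ] = ((k − k⁻¹x⁻²)/(1 − x⁻²)) f(qx) + ((k⁻¹ − kx⁻²)/(1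 − x⁻²)) f(q⁻¹x). -/
/-- With parameters `(k, -k, ν, -ν)` and base `ν ^ 2` the Askey–Wilson coefficient simplifies. -/
theorem Aplus_neg_neg (k ν x : ℂ) (h : 1 - ν ^ 2 * x ^ 2 ≠ 0) :
    Aplus k (-k) ν (-ν) (ν ^ 2) x = (1 - k ^ 2 * x ^ 2) / (1 - x ^ 2) := by
  rw [Aplus, ← mul_div_mul_right (1 - k ^ 2 * x ^ 2) (1 - x ^ 2) h]
  ring

/-- Under the specialization `(k₁,k₀,u₁,u₀) = (k,1,1,1)` the Askey–Wilson operator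
with parameters `(k, -k, q^{1/2}, -q^{1/2})` (plus affine constant, rescaled by `k⁻¹`)
equals the Macdonald–Ruijsenaars operator of type `A₁` with shift `q`; here `ν = q^{1/2}`. -/
theorem stmt_2 (k ν : ℂ) (hk : k ≠ 0) (hν : ν ≠ 0)
    (f : ℂ → ℂ) (x : ℂ) (hx : x ≠ 0) (h1 : x ^ 2 ≠ 1) (h2 : x ^ 2 ≠ ν ^ 2)
    (h3 : x ^ 2 ≠ (ν ^ 2)⁻¹) :
    (k + k⁻¹) * f x + k⁻¹ *
        (Aplus k (-k) ν (-ν) (ν ^ 2) x * (f (ν ^ 2 * x) - f x)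
          + Aplus k (-k) ν (-ν) (ν ^ 2) x⁻¹ * (f ((ν ^ 2)⁻¹ * x) - f x))
      = ((k - k⁻¹ * (x⁻¹) ^ 2) / (1 - (x⁻¹) ^ 2)) * f (ν ^ 2 * x)
        + ((k⁻¹ - k * (x⁻¹) ^ 2) / (1 - (x⁻¹) ^ 2)) * f ((ν ^ 2)⁻¹ * x) := by
  have hq : 1 - ν ^ 2 * x ^ 2 ≠ 0 := fun h =>
    h3 (eq_inv_of_mul_eq_one_right (sub_eq_zero.mp h).symm)
  have hq' : 1 - ν ^ 2 * x⁻¹ ^ 2 ≠ 0 := by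
    intro h
    apply h2
    field_simp at h
    linear_combination h
  rw [Aplus_neg_neg k ν x hq, Aplus_neg_neg k ν x⁻¹ hq']
  generalize f (ν ^ 2 * x) = u
  generalize f ((ν ^ 2)⁻¹ * x) = v
  have hd : x ^ 2 - 1 ≠ 0 := sub_ne_zero.mpr h1
  have hd' : 1 - x ^ 2 = -(x ^ 2 - 1) := by ring
  have hi : 1 - x⁻¹ ^ 2 = (x ^ 2 - 1) / x ^ 2 := by field_simp
  rw [hd', hi]
  field_simp
  ring
end

section
/- Let k ∈ ℂ∖{0} and let q^{1/2} ∈ ℂ∖{0} with q := (q^{1/2})². Let A be the quotient of the free ℂ-algebra on generators T, U, X, X' by the two-sided ideal generated by (T − k)(T + k⁻¹), U² − 1, XX' − 1, X'X − 1, TXT − X', and UXU − qX'. Let B be the quotient of the free ℂ-algebra on generators T₁, T₀, V₁, V₀ by the two-sided ideal generated by (T₁ − k)(T₁ + k⁻¹), T₀² − 1, V₁² − 1, V₀² − 1, and V₁T₁T₀V₀ − q^{−1/2}. Then A and B are isomorphic as ℂ-algebras; an isomorphism B → A is induced by T₁ ↦ T, T₀ ↦ U, V₁ ↦ X'(T −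 k + k⁻¹), V₀ ↦ q^{−1/2}UX. -/
noncomputable section

/-- Free algebra on four generators over `ℂ`. -/
abbrev F4 := FreeAlgebra ℂ (Fin 4)

/-- Scalar embedding into the free algebra. -/
noncomputable def κ (z : ℂ) : F4 := algebraMap ℂ F4 z

/-- Relations of the DAHA of type `A₁`, with generators
`T = ι 0`, `U = ι 1`, `X = ι 2`, `X' = ι 3` and `q = ν²`. -/
inductive RelA (k ν : ℂ) : F4 → F4 → Prop
  | hecke : RelA k ν ((FreeAlgebra.ι ℂ (0 : Fin 4) - κ k) *
      (FreeAlgebra.ι ℂ (0 : Fin 4) + κ k⁻¹)) 0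
  | usq : RelA k ν (FreeAlgebra.ι ℂ (1 : Fin 4) * FreeAlgebra.ι ℂ (1 : Fin 4)) 1
  | xinv₁ : RelA k ν (FreeAlgebra.ι ℂ (2 : Fin 4) * FreeAlgebra.ι ℂ (3 : Fin 4)) 1
  | xinv₂ : RelA k ν (FreeAlgebra.ι ℂ (3 : Fin 4) * FreeAlgebra.ι ℂ (2 : Fin 4)) 1
  | txt : RelA k ν (FreeAlgebra.ι ℂ (0 : Fin 4) * FreeAlgebra.ι ℂ (2 : Fin 4) *
      FreeAlgebra.ι ℂ (0 : Fin 4)) (FreeAlgebra.ι ℂ (3 : Fin 4))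
  | uxu : RelA k ν (FreeAlgebra.ι ℂ (1 : Fin 4) * FreeAlgebra.ι ℂ (2 : Fin 4) *
      FreeAlgebra.ι ℂ (1 : Fin 4)) (κ (ν ^ 2) * FreeAlgebra.ι ℂ (3 : Fin 4))

/-- Relations of the DAHA of type `(C₁^∨,C₁)` with Hecke parameters `(k,1,1,1)`,
with generators `T₁ = ι 0`, `T₀ = ι 1`, `V₁ = ι 2`, `V₀ = ι 3` and `q^{-1/2} = ν⁻¹`. -/
inductive RelB (k ν : ℂ) : F4 → F4 → Prop
  | hecke : RelB k ν ((FreeAlgebra.ι ℂ (0 : Fin 4) - κ k) *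
      (FreeAlgebra.ι ℂ (0 : Fin 4) + κ k⁻¹)) 0
  | t0sq : RelB k ν (FreeAlgebra.ι ℂ (1 : Fin 4) * FreeAlgebra.ι ℂ (1 : Fin 4)) 1
  | v1sq : RelB k ν (FreeAlgebra.ι ℂ (2 : Fin 4) * FreeAlgebra.ι ℂ (2 : Fin 4)) 1
  | v0sq : RelB k ν (FreeAlgebra.ι ℂ (3 : Fin 4) * FreeAlgebra.ι ℂ (3 : Fin 4)) 1
  | quad : RelB k ν (FreeAlgebra.ι ℂ (2 : Fin 4) * FreeAlgebra.ι ℂ (0 : Fin 4) *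
      FreeAlgebra.ι ℂ (1 : Fin 4) * FreeAlgebra.ι ℂ (3 : Fin 4)) (κ ν⁻¹)

section

variable {R : Type*} [Ring R] [Algebra ℂ R] {k ν : ℂ}

/-- Elements of a `ℂ`-algebra satisfying the relations of the DAHA of type `A₁`. -/
structure IsDAHAA (k ν : ℂ) (T U X X' : R) : Prop where
  hecke : (T - k • 1) * (T + k⁻¹ • 1) = 0
  usq : U * U = 1
  xinv₁ : X * X' = 1
  xinv₂ : X' * X = 1
  txt : T * X * T = X'
  uxu : U * X * U = ν ^ 2 • X'

/-- Elements of a `ℂ`-algebra satisfying the relations of the DAHA of type `(C₁^∨,C₁)`. -/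
structure IsDAHAB (k ν : ℂ) (T₁ T₀ V₁ V₀ : R) : Prop where
  hecke : (T₁ - k • 1) * (T₁ + k⁻¹ • 1) = 0
  t0sq : T₀ * T₀ = 1
  v1sq : V₁ * V₁ = 1
  v0sq : V₀ * V₀ = 1
  quad : V₁ * T₁ * T₀ * V₀ = ν⁻¹ • 1

theorem map_κ (f : F4 →ₐ[ℂ] R) (z : ℂ) : f (κ z) = z • 1 := by
  rw [κ, AlgHom.commutes, Algebra.algebraMap_eq_smul_one]

theorem isDAHAA_mk (k ν : ℂ) :
    IsDAHAA k ν (RingQuot.mkAlgHom ℂ (RelA k ν) (FreeAlgebra.ι ℂ 0))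
      (RingQuot.mkAlgHom ℂ (RelA k ν) (FreeAlgebra.ι ℂ 1))
      (RingQuot.mkAlgHom ℂ (RelA k ν) (FreeAlgebra.ι ℂ 2))
      (RingQuot.mkAlgHom ℂ (RelA k ν) (FreeAlgebra.ι ℂ 3)) where
  hecke := by simpa [map_κ] using RingQuot.mkAlgHom_rel ℂ (RelA.hecke (k := k) (ν := ν))
  usq := by simpa using RingQuot.mkAlgHom_rel ℂ (RelA.usq (k := k) (ν := ν))
  xinv₁ := by simpa using RingQuot.mkAlgHom_rel ℂ (RelA.xinv₁ (k := k) (ν := ν))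
  xinv₂ := by simpa using RingQuot.mkAlgHom_rel ℂ (RelA.xinv₂ (k := k) (ν := ν))
  txt := by simpa using RingQuot.mkAlgHom_rel ℂ (RelA.txt (k := k) (ν := ν))
  uxu := by simpa [map_κ] using RingQuot.mkAlgHom_rel ℂ (RelA.uxu (k := k) (ν := ν))

theorem isDAHAB_mk (k ν : ℂ) :
    IsDAHAB k ν (RingQuot.mkAlgHom ℂ (RelB k ν) (FreeAlgebra.ι ℂ 0))
      (RingQuot.mkAlgHom ℂ (RelB k ν) (FreeAlgebra.ι ℂ 1))
      (RingQuot.mkAlgHom ℂ (RelB k ν) (FreeAlgebra.ι ℂ 2))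
      (RingQuot.mkAlgHom ℂ (RelB k ν) (FreeAlgebra.ι ℂ 3)) where
  hecke := by simpa [map_κ] using RingQuot.mkAlgHom_rel ℂ (RelB.hecke (k := k) (ν := ν))
  t0sq := by simpa using RingQuot.mkAlgHom_rel ℂ (RelB.t0sq (k := k) (ν := ν))
  v1sq := by simpa using RingQuot.mkAlgHom_rel ℂ (RelB.v1sq (k := k) (ν := ν))
  v0sq := by simpa using RingQuot.mkAlgHom_rel ℂ (RelB.v0sq (k := k) (ν := ν))
  quad := by simpa [map_κ] using RingQuot.mkAlgHom_rel ℂ (RelB.quad (k := k) (ν := ν))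

/-- The universal property of the DAHA of type `A₁`. -/
theorem IsDAHAA.exists_lift {T U X X' : R} (h : IsDAHAA k ν T U X X') :
    ∃ f : RingQuot (RelA k ν) →ₐ[ℂ] R,
      f (RingQuot.mkAlgHom ℂ (RelA k ν) (FreeAlgebra.ι ℂ 0)) = T ∧
      f (RingQuot.mkAlgHom ℂ (RelA k ν) (FreeAlgebra.ι ℂ 1)) = U ∧
      f (RingQuot.mkAlgHom ℂ (RelA k ν) (FreeAlgebra.ι ℂ 2)) = X ∧
      f (RingQuot.mkAlgHom ℂ (RelA k ν) (FreeAlgebra.ι ℂ 3)) = X' := by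
  refine ⟨RingQuot.liftAlgHom ℂ ⟨FreeAlgebra.lift ℂ ![T, U, X, X'], ?_⟩, ?_⟩
  · rintro _ _ (_ | _ | _ | _ | _ | _)
    · simpa [map_κ] using h.hecke
    · simpa using h.usq
    · simpa using h.xinv₁
    · simpa using h.xinv₂
    · simpa using h.txt
    · simpa [map_κ] using h.uxu
  · simp

/-- The universal property of the DAHA of type `(C₁^∨,C₁)`. -/
theorem IsDAHAB.exists_lift {T₁ T₀ V₁ V₀ : R} (h : IsDAHAB k ν T₁ T₀ V₁ V₀) :
    ∃ f : RingQuot (RelB k ν) →ₐ[ℂ] R,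
      f (RingQuot.mkAlgHom ℂ (RelB k ν) (FreeAlgebra.ι ℂ 0)) = T₁ ∧
      f (RingQuot.mkAlgHom ℂ (RelB k ν) (FreeAlgebra.ι ℂ 1)) = T₀ ∧
      f (RingQuot.mkAlgHom ℂ (RelB k ν) (FreeAlgebra.ι ℂ 2)) = V₁ ∧
      f (RingQuot.mkAlgHom ℂ (RelB k ν) (FreeAlgebra.ι ℂ 3)) = V₀ := by
  refine ⟨RingQuot.liftAlgHom ℂ ⟨FreeAlgebra.lift ℂ ![T₁, T₀, V₁, V₀], ?_⟩, ?_⟩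
  · rintro _ _ (_ | _ | _ | _ | _)
    · simpa [map_κ] using h.hecke
    · simpa using h.t0sq
    · simpa using h.v1sq
    · simpa using h.v0sq
    · simpa [map_κ] using h.quad
  · simp

theorem mul_inv_of_hecke (hk : k ≠ 0) {T : R} (h : (T - k • 1) * (T + k⁻¹ • 1) = 0) :
    T * (T - k • 1 + k⁻¹ • 1) = 1 := by
  have h' : T * (T - k • 1 + k⁻¹ • 1) - 1 = (T - k • 1) * (T + k⁻¹ • 1) := by
    simp only [mul_add, mul_sub, sub_mul, mul_smul_comm, smul_mul_assoc, mul_one, one_mul,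
      smul_sub, smul_smul, inv_mul_cancel₀ hk, one_smul]
    abel
  rwa [h, sub_eq_zero] at h'

theorem inv_mul_of_hecke (hk : k ≠ 0) {T : R} (h : (T - k • 1) * (T + k⁻¹ • 1) = 0) :
    (T - k • 1 + k⁻¹ • 1) * T = 1 := by
  refine Eq.trans ?_ (mul_inv_of_hecke hk h)
  simp [mul_add, add_mul, mul_sub, sub_mul]

theorem IsDAHAA.isDAHAB (hk : k ≠ 0) (hν : ν ≠ 0) {T U X X' : R} (h : IsDAHAA k ν T U X X') :
    IsDAHAB k ν T U (X' * (T - k • 1 + k⁻¹ • 1)) (ν⁻¹ • (U * X)) := by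
  have hr := mul_inv_of_hecke hk h.hecke
  have hl := inv_mul_of_hecke hk h.hecke
  generalize T - k • 1 + k⁻¹ • 1 = S at hr hl ⊢
  refine ⟨h.hecke, h.usq, ?_, ?_, ?_⟩
  · calc X' * S * (X' * S) = X' * (S * (T * X * T) * S) := by rw [h.txt]; noncomm_ring
      _ = X' * ((S * T) * X * (T * S)) := by noncomm_ring
      _ = 1 := by rw [hr, hl, one_mul, mul_one, h.xinv₂]
  · calc ν⁻¹ • (U * X) * ν⁻¹ • (U * X) = (ν⁻¹ * ν⁻¹) • ((U * X * U) * X) := by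
          rw [smul_mul_smul_comm, mul_assoc (U * X)]
      _ = 1 := by
          rw [h.uxu, smul_mul_assoc, h.xinv₂, smul_smul]
          field_simp
          simp
  · calc X' * S * T * U * ν⁻¹ • (U * X) = ν⁻¹ • (X' * (S * T) * (U * U) * X) := by
          rw [mul_smul_comm]; simp only [mul_assoc]
      _ = ν⁻¹ • 1 := by rw [hl, h.usq, mul_one, mul_one, h.xinv₂]

theorem IsDAHAB.isDAHAA (hk : k ≠ 0) (hν : ν ≠ 0) {T₁ T₀ V₁ V₀ : R}
    (h : IsDAHAB k ν T₁ T₀ V₁ V₀) :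
    IsDAHAA k ν T₁ T₀ (ν • (T₀ * V₀)) (V₁ * T₁) := by
  have hl := inv_mul_of_hecke hk h.hecke
  have hV : V₁ * T₁ = ν⁻¹ • (V₀ * T₀) := by
    calc V₁ * T₁ = V₁ * T₁ * (T₀ * (V₀ * V₀) * T₀) := by rw [h.v0sq, mul_one, h.t0sq, mul_one]
      _ = (V₁ * T₁ * T₀ * V₀) * (V₀ * T₀) := by simp only [mul_assoc]
      _ = ν⁻¹ • (V₀ * T₀) := by rw [h.quad, smul_mul_assoc, one_mul]
  refine ⟨h.hecke, h.t0sq, ?_, ?_, ?_, ?_⟩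
  · rw [hV, smul_mul_smul_comm, mul_inv_cancel₀ hν, one_smul, mul_assoc, ← mul_assoc V₀,
      h.v0sq, one_mul, h.t0sq]
  · rw [mul_smul_comm, ← mul_assoc, h.quad, smul_smul, mul_inv_cancel₀ hν, one_smul]
  · calc T₁ * ν • (T₀ * V₀) * T₁ = ν • ((V₁ * V₁) * (T₁ * (T₀ * V₀)) * T₁) := by
          rw [h.v1sq, one_mul, mul_smul_comm, smul_mul_assoc]
      _ = ν • (V₁ * (V₁ * T₁ * T₀ * V₀) * T₁) := by simp only [mul_assoc]
      _ = V₁ * T₁ := by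
          rw [h.quad, mul_smul_comm, mul_one, smul_mul_assoc, smul_smul, mul_inv_cancel₀ hν,
            one_smul]
  · rw [hV, mul_smul_comm, smul_mul_assoc, ← mul_assoc, h.t0sq, one_mul, smul_smul, pow_two,
      mul_assoc, mul_inv_cancel₀ hν, mul_one]

end

/-- The rank-one DAHA isomorphism: the DAHA of type `(C₁^∨,C₁)` with parameters
`(k,1,1,1)` is isomorphic to the DAHA of type `A₁` with parameter `k`, via
`T₁ ↦ T`, `T₀ ↦ U`, `V₁ ↦ X'(T - k + k⁻¹)`, `V₀ ↦ q^{-1/2} U X`. -/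
theorem stmt_3 (k ν : ℂ) (hk : k ≠ 0) (hν : ν ≠ 0) :
    ∃ e : RingQuot (RelB k ν) ≃ₐ[ℂ] RingQuot (RelA k ν),
      e (RingQuot.mkAlgHom ℂ (RelB k ν) (FreeAlgebra.ι ℂ (0 : Fin 4)))
          = RingQuot.mkAlgHom ℂ (RelA k ν) (FreeAlgebra.ι ℂ (0 : Fin 4)) ∧
      e (RingQuot.mkAlgHom ℂ (RelB k ν) (FreeAlgebra.ι ℂ (1 : Fin 4)))
          = RingQuot.mkAlgHom ℂ (RelA k ν) (FreeAlgebra.ι ℂ (1 : Fin 4)) ∧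
      e (RingQuot.mkAlgHom ℂ (RelB k ν) (FreeAlgebra.ι ℂ (2 : Fin 4)))
          = RingQuot.mkAlgHom ℂ (RelA k ν)
              (FreeAlgebra.ι ℂ (3 : Fin 4) *
                (FreeAlgebra.ι ℂ (0 : Fin 4) - κ k + κ k⁻¹)) ∧
      e (RingQuot.mkAlgHom ℂ (RelB k ν) (FreeAlgebra.ι ℂ (3 : Fin 4)))
          = RingQuot.mkAlgHom ℂ (RelA k ν)
              (κ ν⁻¹ * FreeAlgebra.ι ℂ (1 : Fin 4) * FreeAlgebra.ι ℂ (2 : Fin 4)) := by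
  have hA := isDAHAA_mk k ν
  have hB := isDAHAB_mk k ν
  obtain ⟨f, f0, f1, f2, f3⟩ := (hA.isDAHAB hk hν).exists_lift
  obtain ⟨g, g0, g1, g2, g3⟩ := (hB.isDAHAA hk hν).exists_lift
  refine ⟨AlgEquiv.ofAlgHom f g ?_ ?_, f0, f1, ?_, ?_⟩
  · ext i
    fin_cases i
    · simp [f0, g0]
    · simp [f1, g1]
    · simp [f1, f3, g2, ← mul_assoc, hA.usq, smul_smul, hν]
    · simp [f0, f2, g3, mul_assoc, inv_mul_of_hecke hk hA.hecke]
  · ext i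
    fin_cases i
    · simp [f0, g0]
    · simp [f1, g1]
    · simp [f2, g0, g3, mul_assoc, mul_inv_of_hecke hk hB.hecke]
    · simp [f3, g1, g2, ← mul_assoc, hB.t0sq, smul_smul, hν]
  · simpa [map_κ] using f2
  · simpa [map_κ] using f3

end
end

section
/- Let 0 < q < 1 with positive real roots q^{1/4}, q^{1/2}, and let k, ξ ∈ ℂ∖{0}. Define g₊(x) := 𝒲(x, ξ; k⁻¹, q), g₋(x) := 𝒲(x, ξ⁻¹; k⁻¹, q), ĝ₊(x) := θ(−q^{1/4}kxξ; q^{1/2})/θ(−q^{1/4}x; q^{1/2}), ĝ₋(x) := θ(−q^{1/4}kxξ⁻¹; q^{1/2})/θ(−q^{1/4}x; q^{1/2}). Then each g ∈ {g₊, g₋, ĝ₊, ĝ₋} satisfies k·g(q^{1/2}x) + k⁻¹·g(q^{−1/2}x) = (ξ + ξ⁻¹)·g(x) at every x ∈ ℂ∖{0} where the theta denominators defining g are nonzero. Moreover, for x ∈ ℂ∖{0}, the functions h₊(η) := 𝒲(x, η; k⁻¹, q) and h₋(η) := 𝒲(x⁻¹, η; k⁻¹, q) satisfy k⁻¹·h(q^{1/2}η)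 + k·h(q^{−1/2}η) = (x + x⁻¹)·h(η) at every η where the theta denominators are nonzero. -/
/-- The Jacobi theta function
`θ(z;q) = ∏_{n≥0} (1 - q^{n+1})(1 - qⁿ z)(1 - q^{n+1} z⁻¹)`. -/
noncomputable def theta (z q : ℂ) : ℂ :=
  ∏' n : ℕ, ((1 - q ^ (n + 1)) * (1 - q ^ n * z) * (1 - q ^ (n + 1) * z⁻¹))

/-- The positive real fourth root `q^{1/4}`, as a complex number. -/
noncomputable def q4 (q : ℝ) : ℂ := ((q ^ ((1 : ℝ)/4) : ℝ) : ℂ)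

/-- The positive real square root `q^{1/2}`, as a complex number. -/
noncomputable def q2 (q : ℝ) : ℂ := ((q ^ ((1 : ℝ)/2) : ℝ) : ℂ)

/-- The weight function
`𝒲(x,ξ;k,q) = θ(-q^{1/4}xξ; q^{1/2}) / (θ(-q^{1/4}kx; q^{1/2}) θ(-q^{1/4}k⁻¹ξ; q^{1/2}))`. -/
noncomputable def Wfun (q : ℝ) (k x ξ : ℂ) : ℂ :=
  theta (-q4 q * x * ξ) (q2 q) /
    (theta (-q4 q * k * x) (q2 q) * theta (-q4 q * k⁻¹ * ξ) (q2 q))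

lemma multipliable_one_sub_pow_mul {p : ℂ} (hp : ‖p‖ < 1) (c : ℂ) :
    Multipliable fun n : ℕ => 1 - p ^ n * c := by
  have h : Summable fun n : ℕ => ‖-(p ^ n * c)‖ := by
    simpa using (summable_geometric_of_lt_one (norm_nonneg p) hp).mul_right ‖c‖
  simpa [sub_eq_add_neg] using multipliable_one_add_of_summable h

lemma multipliable_one_sub_pow_succ_mul {p : ℂ} (hp : ‖p‖ < 1) (c : ℂ) :
    Multipliable fun n : ℕ => 1 - p ^ (n + 1) * c := by
  simpa [pow_succ, mul_assoc] using multipliable_one_sub_pow_mul hp (p * c)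

lemma tprod_one_sub_pow_mul {p : ℂ} (hp : ‖p‖ < 1) (c : ℂ) :
    ∏' n : ℕ, (1 - p ^ n * c) = (1 - c) * ∏' n : ℕ, (1 - p ^ (n + 1) * c) := by
  simpa using tprod_eq_zero_mul' (f := fun n : ℕ => 1 - p ^ n * c)
    (multipliable_one_sub_pow_succ_mul hp c)

lemma theta_eq_mul_tprod {p : ℂ} (hp : ‖p‖ < 1) (z : ℂ) :
    theta z p = (∏' n : ℕ, (1 - p ^ (n + 1))) * (∏' n : ℕ, (1 - p ^ n * z)) *
      ∏' n : ℕ, (1 - p ^ (n + 1) * z⁻¹) := by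
  have h1 : Multipliable fun n : ℕ => 1 - p ^ (n + 1) := by
    simpa using multipliable_one_sub_pow_succ_mul hp 1
  have h2 := multipliable_one_sub_pow_mul hp z
  rw [theta, (h1.mul h2).tprod_mul (multipliable_one_sub_pow_succ_mul hp z⁻¹), h1.tprod_mul h2]

/-- Quasi-periodicity of the Jacobi theta function. -/
lemma theta_mul_left {p : ℂ} (hp : ‖p‖ < 1) (hp0 : p ≠ 0) {z : ℂ} (hz : z ≠ 0) :
    theta (p * z) p = -z⁻¹ * theta z p := by
  have h1 (n : ℕ) : p ^ n * (p * z) = p ^ (n + 1) * z := by ring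
  have h2 (n : ℕ) : p ^ (n + 1) * (p * z)⁻¹ = p ^ n * z⁻¹ := by
    field_simp
    ring
  rw [theta_eq_mul_tprod hp, theta_eq_mul_tprod hp]
  simp only [h1, h2]
  rw [tprod_one_sub_pow_mul hp z, tprod_one_sub_pow_mul hp z⁻¹]
  linear_combination (∏' n : ℕ, (1 - p ^ (n + 1))) * (∏' n : ℕ, (1 - p ^ (n + 1) * z)) *
    (∏' n : ℕ, (1 - p ^ (n + 1) * z⁻¹)) * -inv_mul_cancel₀ hz

lemma q2_ne_zero {q : ℝ} (hq0 : 0 < q) : q2 q ≠ 0 :=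
  Complex.ofReal_ne_zero.2 (Real.rpow_pos_of_pos hq0 _).ne'

lemma q4_ne_zero {q : ℝ} (hq0 : 0 < q) : q4 q ≠ 0 :=
  Complex.ofReal_ne_zero.2 (Real.rpow_pos_of_pos hq0 _).ne'

lemma norm_q2_lt_one {q : ℝ} (hq0 : 0 < q) (hq1 : q < 1) : ‖q2 q‖ < 1 := by
  rw [q2, Complex.norm_of_nonneg (Real.rpow_nonneg hq0.le _)]
  exact Real.rpow_lt_one hq0.le hq1 (by norm_num)

lemma theta_div_theta_mul_left {p : ℂ} (hp : ‖p‖ < 1) (hp0 : p ≠ 0) {a b : ℂ}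
    (ha : a ≠ 0) (hb : b ≠ 0) :
    theta (p * a) p / theta (p * b) p = b / a * (theta a p / theta b p) := by
  rw [theta_mul_left hp hp0 ha, theta_mul_left hp hp0 hb, mul_div_mul_comm]
  congr 1
  field_simp

lemma theta_div_theta_inv_mul_left {p : ℂ} (hp : ‖p‖ < 1) (hp0 : p ≠ 0) {a b : ℂ}
    (ha : a ≠ 0) (hb : b ≠ 0) :
    theta (p⁻¹ * a) p / theta (p⁻¹ * b) p = a / b * (theta a p / theta b p) := by
  have h := theta_div_theta_mul_left hp hp0 (mul_ne_zero (inv_ne_zero hp0) ha)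
    (mul_ne_zero (inv_ne_zero hp0) hb)
  rw [mul_inv_cancel_left₀ hp0, mul_inv_cancel_left₀ hp0] at h
  rw [h]
  field_simp

/-- A quotient of theta functions whose arguments have ratio `u * v` is an eigenfunction of the
weighted sum of the two opposite shifts. -/
lemma theta_div_theta_shift_add_shift {p : ℂ} (hp : ‖p‖ < 1) (hp0 : p ≠ 0) {u v b : ℂ}
    (hu : u ≠ 0) (hv : v ≠ 0) (hb : b ≠ 0) :
    u * (theta (p * (u * v * b)) p / theta (p * b) p) +
        u⁻¹ * (theta (p⁻¹ * (u * v * b)) p / theta (p⁻¹ * b) p) =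
      (v + v⁻¹) * (theta (u * v * b) p / theta b p) := by
  rw [theta_div_theta_mul_left hp hp0 (by positivity) hb,
    theta_div_theta_inv_mul_left hp hp0 (by positivity) hb]
  field_simp
  ring

lemma theta_quotient_equation {q : ℝ} (hq0 : 0 < q) (hq1 : q < 1) {k ξ x : ℂ}
    (hk : k ≠ 0) (hξ : ξ ≠ 0) (hx : x ≠ 0) :
    k * (theta (-q4 q * k * (q2 q * x) * ξ) (q2 q) / theta (-q4 q * (q2 q * x)) (q2 q))
        + k⁻¹ * (theta (-q4 q * k * ((q2 q)⁻¹ * x) * ξ) (q2 q) /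
            theta (-q4 q * ((q2 q)⁻¹ * x)) (q2 q))
      = (ξ + ξ⁻¹) * (theta (-q4 q * k * x * ξ) (q2 q) / theta (-q4 q * x) (q2 q)) := by
  have h := theta_div_theta_shift_add_shift (norm_q2_lt_one hq0 hq1) (q2_ne_zero hq0) hk hξ
    (mul_ne_zero (neg_ne_zero.2 (q4_ne_zero hq0)) hx)
  have h1 (c : ℂ) : -q4 q * k * (c * x) * ξ = c * (k * ξ * (-q4 q * x)) := by ring
  have h2 : -q4 q * k * x * ξ = k * ξ * (-q4 q * x) := by ring
  rw [h1, h1, h2, mul_left_comm (-q4 q), mul_left_comm (-q4 q)]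
  exact h

lemma Wfun_eq_div (q : ℝ) {k : ℂ} (hk : k ≠ 0) (x ξ : ℂ) :
    Wfun q k⁻¹ x ξ = theta (-q4 q * k * (k⁻¹ * x) * ξ) (q2 q) / theta (-q4 q * (k⁻¹ * x)) (q2 q) /
      theta (-q4 q * k * ξ) (q2 q) := by
  rw [Wfun, inv_inv, div_div, ← mul_assoc _ k⁻¹, ← mul_assoc _ k⁻¹,
    mul_inv_cancel_right₀ hk]

lemma Wfun_symm (q : ℝ) (k x ξ : ℂ) : Wfun q k x ξ = Wfun q k⁻¹ ξ x := by
  rw [Wfun, Wfun, inv_inv, mul_right_comm, mul_comm (theta (-q4 q * k * x) (q2 q))]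

/-- The asymptotic difference equation of the weight function in its first variable. -/
lemma Wfun_equation {q : ℝ} (hq0 : 0 < q) (hq1 : q < 1) {k ξ x : ℂ}
    (hk : k ≠ 0) (hξ : ξ ≠ 0) (hx : x ≠ 0) :
    k * Wfun q k⁻¹ (q2 q * x) ξ + k⁻¹ * Wfun q k⁻¹ ((q2 q)⁻¹ * x) ξ
      = (ξ + ξ⁻¹) * Wfun q k⁻¹ x ξ := by
  have h := theta_quotient_equation hq0 hq1 hk hξ (mul_ne_zero (inv_ne_zero hk) hx)
  simp only [Wfun_eq_div q hk, mul_left_comm k⁻¹ (q2 q), mul_left_comm k⁻¹ (q2 q)⁻¹]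
  rw [← mul_div_assoc (ξ + ξ⁻¹), ← h, add_div, mul_div_assoc k, mul_div_assoc k⁻¹]

/-- The asymptotic difference equation of the weight function in its second variable. -/
lemma Wfun_dual_equation {q : ℝ} (hq0 : 0 < q) (hq1 : q < 1) {k x η : ℂ}
    (hk : k ≠ 0) (hx : x ≠ 0) (hη : η ≠ 0) :
    k⁻¹ * Wfun q k⁻¹ x (q2 q * η) + k * Wfun q k⁻¹ x ((q2 q)⁻¹ * η)
      = (x + x⁻¹) * Wfun q k⁻¹ x η := by
  simpa only [Wfun_symm q k⁻¹ x, inv_inv] using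
    Wfun_equation hq0 hq1 (inv_ne_zero hk) hx hη

/-- The four functions `g₊(x) = 𝒲(x,ξ;k⁻¹,q)`, `g₋(x) = 𝒲(x,ξ⁻¹;k⁻¹,q)`,
`ĝ₊(x) = θ(-q^{1/4}kxξ)/θ(-q^{1/4}x)`, `ĝ₋(x) = θ(-q^{1/4}kxξ⁻¹)/θ(-q^{1/4}x)`
solve the asymptotic `x`-side equation
`k·g(q^{1/2}x) + k⁻¹·g(q^{-1/2}x) = (ξ+ξ⁻¹)·g(x)`, and
`h₊(η) = 𝒲(x,η;k⁻¹,q)`, `h₋(η) = 𝒲(x⁻¹,η;k⁻¹,q)` solve the asymptotic `ξ`-side equation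
`k⁻¹·h(q^{1/2}η) + k·h(q^{-1/2}η) = (x+x⁻¹)·h(η)`. -/
theorem stmt_7 (q : ℝ) (hq0 : 0 < q) (hq1 : q < 1) (k ξ : ℂ)
    (hk : k ≠ 0) (hξ : ξ ≠ 0) :
    (∀ x : ℂ, x ≠ 0 → theta (-q4 q * k⁻¹ * x) (q2 q) ≠ 0 →
        theta (-q4 q * k * ξ) (q2 q) ≠ 0 →
        k * Wfun q k⁻¹ (q2 q * x) ξ + k⁻¹ * Wfun q k⁻¹ ((q2 q)⁻¹ * x) ξ
          = (ξ + ξ⁻¹) * Wfun q k⁻¹ x ξ) ∧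
    (∀ x : ℂ, x ≠ 0 → theta (-q4 q * k⁻¹ * x) (q2 q) ≠ 0 →
        theta (-q4 q * k * ξ⁻¹) (q2 q) ≠ 0 →
        k * Wfun q k⁻¹ (q2 q * x) ξ⁻¹ + k⁻¹ * Wfun q k⁻¹ ((q2 q)⁻¹ * x) ξ⁻¹
          = (ξ + ξ⁻¹) * Wfun q k⁻¹ x ξ⁻¹) ∧
    (∀ x : ℂ, x ≠ 0 → theta (-q4 q * x) (q2 q) ≠ 0 →
        k * (theta (-q4 q * k * (q2 q * x) * ξ) (q2 q) / theta (-q4 q * (q2 q * x)) (q2 q))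
          + k⁻¹ * (theta (-q4 q * k * ((q2 q)⁻¹ * x) * ξ) (q2 q) /
              theta (-q4 q * ((q2 q)⁻¹ * x)) (q2 q))
          = (ξ + ξ⁻¹) * (theta (-q4 q * k * x * ξ) (q2 q) / theta (-q4 q * x) (q2 q))) ∧
    (∀ x : ℂ, x ≠ 0 → theta (-q4 q * x) (q2 q) ≠ 0 →
        k * (theta (-q4 q * k * (q2 q * x) * ξ⁻¹) (q2 q) / theta (-q4 q * (q2 q * x)) (q2 q))
          + k⁻¹ * (theta (-q4 q * k * ((q2 q)⁻¹ * x) * ξ⁻¹) (q2 q) /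
              theta (-q4 q * ((q2 q)⁻¹ * x)) (q2 q))
          = (ξ + ξ⁻¹) * (theta (-q4 q * k * x * ξ⁻¹) (q2 q) / theta (-q4 q * x) (q2 q))) ∧
    (∀ x η : ℂ, x ≠ 0 → η ≠ 0 → theta (-q4 q * k⁻¹ * x) (q2 q) ≠ 0 →
        theta (-q4 q * k * η) (q2 q) ≠ 0 →
        k⁻¹ * Wfun q k⁻¹ x (q2 q * η) + k * Wfun q k⁻¹ x ((q2 q)⁻¹ * η)
          = (x + x⁻¹) * Wfun q k⁻¹ x η) ∧
    (∀ x η : ℂ, x ≠ 0 → η ≠ 0 → theta (-q4 q * k⁻¹ * x⁻¹) (q2 q) ≠ 0 →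
        theta (-q4 q * k * η) (q2 q) ≠ 0 →
        k⁻¹ * Wfun q k⁻¹ x⁻¹ (q2 q * η) + k * Wfun q k⁻¹ x⁻¹ ((q2 q)⁻¹ * η)
          = (x + x⁻¹) * Wfun q k⁻¹ x⁻¹ η) := by
  have hξ' := inv_ne_zero hξ
  refine ⟨fun x hx _ _ => Wfun_equation hq0 hq1 hk hξ hx, fun x hx _ _ => ?_,
    fun x hx _ => theta_quotient_equation hq0 hq1 hk hξ hx, fun x hx _ => ?_,
    fun x η hx hη _ _ => Wfun_dual_equation hq0 hq1 hk hx hη, fun x η hx hη _ _ => ?_⟩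
  · simpa only [inv_inv, add_comm ξ⁻¹ ξ] using Wfun_equation hq0 hq1 hk hξ' hx
  · simpa only [inv_inv, add_comm ξ⁻¹ ξ] using theta_quotient_equation hq0 hq1 hk hξ' hx
  · simpa only [inv_inv, add_comm x⁻¹ x] using
      Wfun_dual_equation hq0 hq1 hk (inv_ne_zero hx) hη
end

section
/- Let q, k, ξ ∈ ℂ∖{0} with a fixed square root q^{1/2}. Let W : ℂ∖{0} → ℂ satisfy W(q^{1/2}y) = (kξ)⁻¹ W(y) for all y ∈ ℂ∖{0}. Let u : ℂ∖{0} → ℂ and define f(y) := W(y) · u(q k⁻² y⁻²). Fix x ∈ ℂ∖{0} with x² ≠ 1 and W(x) ≠ 0, and set z := q k⁻² x⁻². Then the Macdonald–Ruijsenaars eigenvalue equation ((k − k⁻¹x⁻²)/(1 − x⁻²)) f(q^{1/2}x) + ((k⁻¹ − kx⁻²)/(1 − x⁻²)) f(q^{−1/2}x) = (ξ + ξ⁻¹) f(x) holds if and only if ξ²(1 − k⁴z/q) u(qz) + (1 − z/q) u(q⁻¹z) = (1 + ξ²)(1 − k²z/q) u(z) holds. -/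
/-- Gauge equivalence between the type `A₁` Macdonald–Ruijsenaars eigenvalue
equation and Heine's basic hypergeometric `q`-difference equation with
parameters `(k², k²ξ², qξ²)`; here `qh = q^{1/2}`. -/
theorem stmt_8 (q qh k ξ : ℂ) (hqh : qh ^ 2 = q) (hq : q ≠ 0)
    (hk : k ≠ 0) (hξ : ξ ≠ 0)
    (W : ℂ → ℂ) (hW : ∀ y : ℂ, y ≠ 0 → W (qh * y) = (k * ξ)⁻¹ * W y)
    (u : ℂ → ℂ)
    (f : ℂ → ℂ) (hf : ∀ y : ℂ, f y = W y * u (q * (k ^ 2)⁻¹ * (y ^ 2)⁻¹))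
    (x : ℂ) (hx : x ≠ 0) (hx1 : x ^ 2 ≠ 1) (hWx : W x ≠ 0)
    (z : ℂ) (hz : z = q * (k ^ 2)⁻¹ * (x ^ 2)⁻¹) :
    (((k - k⁻¹ * (x⁻¹) ^ 2) / (1 - (x⁻¹) ^ 2)) * f (qh * x)
        + ((k⁻¹ - k * (x⁻¹) ^ 2) / (1 - (x⁻¹) ^ 2)) * f (qh⁻¹ * x)
      = (ξ + ξ⁻¹) * f x)
    ↔ (ξ ^ 2 * (1 - k ^ 4 * z / q) * u (q * z) + (1 - z / q) * u (q⁻¹ * z)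
        = (1 + ξ ^ 2) * (1 - k ^ 2 * z / q) * u z) := by
  have hqh0 : qh ≠ 0 := by
    rintro rfl
    exact hq (by simpa using hqh.symm)
  have hX' : 1 - (x⁻¹) ^ 2 ≠ 0 := by
    rw [inv_pow, sub_ne_zero, ne_comm]
    simpa using hx1
  have hWdown : W (qh⁻¹ * x) = k * ξ * W x := by
    have h := hW (qh⁻¹ * x) (mul_ne_zero (inv_ne_zero hqh0) hx)
    rw [mul_inv_cancel_left₀ hqh0] at h
    rw [h, mul_inv_cancel_left₀ (mul_ne_zero hk hξ)]
  have hup : f (qh * x) = (k * ξ)⁻¹ * W x * u (q⁻¹ * z) := by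
    have h : q * (k ^ 2)⁻¹ * ((qh * x) ^ 2)⁻¹ = q⁻¹ * z := by
      rw [hz, mul_pow, hqh]
      field_simp
    rw [hf, hW x hx, h]
  have hdown : f (qh⁻¹ * x) = k * ξ * W x * u (q * z) := by
    have h : q * (k ^ 2)⁻¹ * ((qh⁻¹ * x) ^ 2)⁻¹ = q * z := by
      rw [hz, mul_pow, inv_pow, hqh]
      field_simp
    rw [hf, hWdown, h]
  have hmid : f x = W x * u z := by rw [hf, ← hz]
  have hzq : z / q = (k ^ 2)⁻¹ * (x⁻¹) ^ 2 := by
    rw [hz]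
    field_simp
  rw [hup, hdown, hmid, mul_div_assoc, mul_div_assoc, hzq]
  generalize u (q⁻¹ * z) = a
  generalize u (q * z) = b
  generalize u z = c
  have hfactor : W x / (ξ * (1 - (x⁻¹) ^ 2)) ≠ 0 :=
    div_ne_zero hWx (mul_ne_zero hξ hX')
  rw [← sub_eq_zero, ← sub_eq_zero (b := (1 + ξ ^ 2) * _ * c),
    ← mul_eq_zero_iff_left (b := _ - (1 + ξ ^ 2) * _ * c) hfactor]
  refine Eq.congr_left ?_
  field_simp
  ring
end

section
/- Let 0 < q < 1 with positive real roots q^{1/4}, q^{1/2}, let l ∈ ℕ, and let k ∈ ℂ∖{0} with k² ≠ qᵐ and k⁴ ≠ qᵐ for every integer m. Set ξ_l := k⁻¹q^{−l/2}. Then there exists a nonzero constant c ∈ ℂ, independent of x, such that for every x ∈ ℂ∖{0} with θ(−q^{1/4}k⁻¹x; q^{1/2}) ≠ 0 one has f(x, ξ_l) = c · P_l(x). -/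
/-- The finite `q`-shifted factorial `(a;q)_n`. -/
noncomputable def qpoch (a q : ℂ) (n : ℕ) : ℂ := ∏ j ∈ Finset.range n, (1 - a * q ^ j)

/-- The infinite `q`-shifted factorial `(a;q)_∞`. -/
noncomputable def qpochInf (a q : ℂ) : ℂ := ∏' j : ℕ, (1 - a * q ^ j)

/-- The Noumi–Shiraishi/Stokman bispectral function of type `A₁`:
`f(x,ξ) = 𝒲(x,ξ;k⁻¹,q) · ((qξ²;q)_∞/(qk⁻²ξ²;q)_∞) ·
  Σ_n ((k²;q)_n (k²ξ²;q)_n)/((q;q)_n (qξ²;q)_n) (q/(k²x²))ⁿ`. -/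
noncomputable def NSf (q : ℝ) (k x ξ : ℂ) : ℂ :=
  Wfun q k⁻¹ x ξ *
    (qpochInf ((q : ℂ) * ξ ^ 2) (q : ℂ) / qpochInf ((q : ℂ) * (k ^ 2)⁻¹ * ξ ^ 2) (q : ℂ)) *
    ∑' n : ℕ, (qpoch (k ^ 2) (q : ℂ) n * qpoch (k ^ 2 * ξ ^ 2) (q : ℂ) n) /
        (qpoch (q : ℂ) (q : ℂ) n * qpoch ((q : ℂ) * ξ ^ 2) (q : ℂ) n) *
        ((q : ℂ) / (k ^ 2 * x ^ 2)) ^ n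

/-- The Rogers (continuous `q`-ultraspherical, Macdonald type `A₁`) polynomial
`P_l(x) = x^l Σ_{n=0}^{l} ((k²;q)_n (q^{-l};q)_n)/((q;q)_n (k⁻²q^{1-l};q)_n) (q/(k²x²))ⁿ`. -/
noncomputable def RogersP (q k : ℂ) (l : ℕ) (x : ℂ) : ℂ :=
  x ^ l * ∑ n ∈ Finset.range (l + 1),
    (qpoch (k ^ 2) q n * qpoch ((q⁻¹) ^ l) q n) /
      (qpoch q q n * qpoch ((k ^ 2)⁻¹ * q * (q⁻¹) ^ l) q n) *
      (q / (k ^ 2 * x ^ 2)) ^ n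

lemma summable_norm_neg_mul_pow (a : ℂ) {q : ℂ} (hq : ‖q‖ < 1) :
    Summable fun j : ℕ => ‖-(a * q ^ j)‖ := by
  simp only [norm_neg, norm_mul, norm_pow]
  exact (summable_geometric_of_lt_one (norm_nonneg q) hq).mul_left _

lemma multipliable_one_sub_mul_pow (a : ℂ) {q : ℂ} (hq : ‖q‖ < 1) :
    Multipliable fun j : ℕ => 1 - a * q ^ j := by
  simpa only [← sub_eq_add_neg] using
    multipliable_one_add_of_summable (summable_norm_neg_mul_pow a hq)

lemma qpochInf_ne_zero {a q : ℂ} (hq : ‖q‖ < 1) (h : ∀ j : ℕ, a * q ^ j ≠ 1) :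
    qpochInf a q ≠ 0 := by
  have := tprod_one_add_ne_zero_of_summable (f := fun j : ℕ => -(a * q ^ j))
    (fun j => by rw [← sub_eq_add_neg]; exact sub_ne_zero.mpr (h j).symm)
    (summable_norm_neg_mul_pow a hq)
  simpa only [qpochInf, ← sub_eq_add_neg] using this

lemma qpochInf_eq_one_sub_mul (a : ℂ) {q : ℂ} (hq : ‖q‖ < 1) :
    qpochInf a q = (1 - a) * qpochInf (a * q) q := by
  have hshift : ∀ j : ℕ, 1 - a * q * q ^ j = 1 - a * q ^ (j + 1) := fun j => by ring
  have hm := multipliable_one_sub_mul_pow (a * q) hq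
  simp only [hshift] at hm
  simp only [qpochInf, hshift]
  simpa using tprod_eq_zero_mul' (f := fun j : ℕ => 1 - a * q ^ j) hm

/-- A finite `q`-shifted factorial based at `q^{-l}` vanishes beyond length `l`. -/
lemma qpoch_inv_pow_eq_zero {q : ℂ} (hq : q ≠ 0) {l n : ℕ} (h : l < n) :
    qpoch (q⁻¹ ^ l) q n = 0 := by
  refine Finset.prod_eq_zero (Finset.mem_range.mpr h) ?_
  rw [← mul_pow, inv_mul_cancel₀ hq, one_pow, sub_self]

lemma theta_eq_qpochInf (z : ℂ) {q : ℂ} (hq : ‖q‖ < 1) :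
    theta z q = qpochInf q q * qpochInf z q * qpochInf (q * z⁻¹) q := by
  have h1 := multipliable_one_sub_mul_pow q hq
  have h2 := multipliable_one_sub_mul_pow z hq
  have h3 := multipliable_one_sub_mul_pow (q * z⁻¹) hq
  rw [qpochInf, qpochInf, qpochInf, ← h1.tprod_mul h2, ← (h1.mul h2).tprod_mul h3, theta]
  refine tprod_congr fun n => ?_
  ring

lemma theta_inv_mul {z q : ℂ} (hz : z ≠ 0) (hq0 : q ≠ 0) (hq : ‖q‖ < 1) :
    theta (q⁻¹ * z) q = -(q⁻¹ * z) * theta z q := by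
  have hinv : q * (q⁻¹ * z)⁻¹ = q * z⁻¹ * q := by rw [mul_inv, inv_inv]; ring
  have hcancel : q⁻¹ * z * q = z := by field_simp
  rw [theta_eq_qpochInf _ hq, theta_eq_qpochInf z hq, hinv,
    qpochInf_eq_one_sub_mul (q⁻¹ * z) hq, hcancel, qpochInf_eq_one_sub_mul (q * z⁻¹) hq]
  field_simp
  ring

/-- Quasi-periodicity of the theta function under iterated shifts by `q⁻¹`. -/
lemma exists_theta_inv_pow_mul {q : ℂ} (hq0 : q ≠ 0) (hq : ‖q‖ < 1) (l : ℕ) :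
    ∃ C : ℂ, C ≠ 0 ∧ ∀ z : ℂ, z ≠ 0 → theta (q⁻¹ ^ l * z) q = C * z ^ l * theta z q := by
  induction l with
  | zero => exact ⟨1, one_ne_zero, fun z _ => by simp⟩
  | succ l ih =>
    obtain ⟨C, hC, h⟩ := ih
    refine ⟨-(q⁻¹ ^ (l + 1)) * C, by simp [hq0, hC], fun z hz => ?_⟩
    rw [pow_succ', mul_assoc,
      theta_inv_mul (mul_ne_zero (pow_ne_zero _ (inv_ne_zero hq0)) hz) hq0 hq, h z hz]
    ring

/-- `θ(-r; s) ≠ 0` for positive `r` and `0 < s < 1`: every factor of the product is positive. -/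
lemma theta_neg_ofReal_ne_zero {r s : ℝ} (hr : 0 < r) (hs0 : 0 < s) (hs1 : s < 1) :
    theta (-(r : ℂ)) (s : ℂ) ≠ 0 := by
  have hs : ‖(s : ℂ)‖ < 1 := by simpa [abs_of_pos hs0] using hs1
  have hneg : ∀ a : ℝ, 0 < a → qpochInf (-(a : ℂ)) s ≠ 0 := fun a ha => by
    refine qpochInf_ne_zero hs fun j hj => ?_
    have hj' : -a * s ^ j = 1 := by exact_mod_cast hj
    have : 0 < a * s ^ j := by positivity
    linarith
  rw [theta_eq_qpochInf _ hs]
  refine mul_ne_zero (mul_ne_zero (qpochInf_ne_zero hs fun j hj => ?_) (hneg r hr)) ?_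
  · have hj' : s ^ (j + 1) = 1 := by rw [pow_succ']; exact_mod_cast hj
    exact (pow_lt_one₀ hs0.le hs1 j.succ_ne_zero).ne hj'
  · have := hneg (s * r⁻¹) (by positivity)
    rw [inv_neg, mul_neg]
    exact_mod_cast this

lemma q2_sq {q : ℝ} (hq : 0 ≤ q) : q2 q ^ 2 = q := by
  rw [q2, ← Complex.ofReal_pow, ← Real.sqrt_eq_rpow, Real.sq_sqrt hq]

/-- `(a⁻¹ q^{1-l}; q)_∞ ≠ 0` when `a` is not an integral power of `q`. -/
lemma qpochInf_mul_inv_pow_ne_zero {a q : ℂ} (hq0 : q ≠ 0) (hq : ‖q‖ < 1)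
    (ha0 : a ≠ 0) (ha : ∀ m : ℤ, a ≠ q ^ m) (l : ℕ) :
    qpochInf (a⁻¹ * q * q⁻¹ ^ l) q ≠ 0 := by
  refine qpochInf_ne_zero hq fun j hj => ha (1 - l + j) ?_
  rw [zpow_add₀ hq0, zpow_sub₀ hq0, zpow_one, zpow_natCast, zpow_natCast]
  rw [inv_pow] at hj
  field_simp at hj ⊢
  linear_combination -hj

/-- At the spectral point `ξ_l = k⁻¹ q^{-l/2}` the Noumi–Shiraishi/Stokman
function of type `A₁` is a nonzero constant multiple of the Rogers polynomial. -/
theorem stmt_12 (q : ℝ) (hq0 : 0 < q) (hq1 : q < 1) (l : ℕ) (k : ℂ) (hk : k ≠ 0)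
    (hk2 : ∀ m : ℤ, k ^ 2 ≠ (q : ℂ) ^ m) (hk4 : ∀ m : ℤ, k ^ 4 ≠ (q : ℂ) ^ m) :
    ∃ c : ℂ, c ≠ 0 ∧ ∀ x : ℂ, x ≠ 0 →
      theta (-q4 q * k⁻¹ * x) (q2 q) ≠ 0 →
      NSf q k x (k⁻¹ * ((q2 q)⁻¹) ^ l) = c * RogersP (q : ℂ) k l x := by
  have hs0 : 0 < q ^ ((1 : ℝ) / 2) := by positivity
  have hs1 : q ^ ((1 : ℝ) / 2) < 1 := Real.rpow_lt_one hq0.le hq1 (by norm_num)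
  have hr0 : 0 < q ^ ((1 : ℝ) / 4) := by positivity
  have hs : ‖q2 q‖ < 1 := by
    rw [q2, Complex.norm_real, Real.norm_of_nonneg hs0.le]; exact hs1
  have hq : ‖(q : ℂ)‖ < 1 := by rwa [Complex.norm_real, Real.norm_of_nonneg hq0.le]
  have hsne : q2 q ≠ 0 := Complex.ofReal_ne_zero.mpr hs0.ne'
  have hrne : q4 q ≠ 0 := Complex.ofReal_ne_zero.mpr hr0.ne'
  have hqne : (q : ℂ) ≠ 0 := Complex.ofReal_ne_zero.mpr hq0.ne'
  have htheta : theta (-q4 q) (q2 q) ≠ 0 := theta_neg_ofReal_ne_zero hr0 hs0 hs1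
  obtain ⟨C, hC, hshift⟩ := exists_theta_inv_pow_mul hsne hs l
  have hξ : (k⁻¹ * (q2 q)⁻¹ ^ l) ^ 2 = (k ^ 2)⁻¹ * (q : ℂ)⁻¹ ^ l := by
    rw [mul_pow, inv_pow, pow_right_comm, inv_pow (q2 q) 2, q2_sq hq0.le]
  have hnum : qpochInf ((k ^ 2)⁻¹ * q * (q : ℂ)⁻¹ ^ l) q ≠ 0 :=
    qpochInf_mul_inv_pow_ne_zero hqne hq (pow_ne_zero 2 hk) hk2 l
  have hden : qpochInf ((k ^ 4)⁻¹ * q * (q : ℂ)⁻¹ ^ l) q ≠ 0 :=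
    qpochInf_mul_inv_pow_ne_zero hqne hq (pow_ne_zero 4 hk) hk4 l
  refine ⟨k⁻¹ ^ l / theta (-q4 q) (q2 q) *
    (qpochInf ((k ^ 2)⁻¹ * q * (q : ℂ)⁻¹ ^ l) q / qpochInf ((k ^ 4)⁻¹ * q * (q : ℂ)⁻¹ ^ l) q),
    mul_ne_zero (div_ne_zero (pow_ne_zero _ (inv_ne_zero hk)) htheta) (div_ne_zero hnum hden),
    fun x hx hθ => ?_⟩
  have hW : Wfun q k⁻¹ x (k⁻¹ * (q2 q)⁻¹ ^ l) =
      k⁻¹ ^ l / theta (-q4 q) (q2 q) * x ^ l := by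
    have h1 : -q4 q * x * (k⁻¹ * (q2 q)⁻¹ ^ l) = (q2 q)⁻¹ ^ l * (-q4 q * k⁻¹ * x) := by ring
    have h2 : -q4 q * k⁻¹⁻¹ * (k⁻¹ * (q2 q)⁻¹ ^ l) = (q2 q)⁻¹ ^ l * -q4 q := by
      field_simp
    rw [Wfun, h1, h2, hshift _ (by simp [hrne, hk, hx]), hshift _ (neg_ne_zero.mpr hrne),
      mul_pow, mul_pow]
    generalize theta (-q4 q * k⁻¹ * x) (q2 q) = T at hθ ⊢
    have hpow : (-q4 q) ^ l ≠ 0 := pow_ne_zero _ (neg_ne_zero.mpr hrne)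
    field_simp
  have ha : (q : ℂ) * ((k ^ 2)⁻¹ * (q : ℂ)⁻¹ ^ l) = (k ^ 2)⁻¹ * q * (q : ℂ)⁻¹ ^ l := by ring
  have hb : (q : ℂ) * (k ^ 2)⁻¹ * ((k ^ 2)⁻¹ * (q : ℂ)⁻¹ ^ l) =
      (k ^ 4)⁻¹ * q * (q : ℂ)⁻¹ ^ l := by
    rw [show k ^ 4 = k ^ 2 * k ^ 2 by ring, mul_inv]; ring
  have hc : k ^ 2 * ((k ^ 2)⁻¹ * (q : ℂ)⁻¹ ^ l) = (q : ℂ)⁻¹ ^ l :=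
    mul_inv_cancel_left₀ (pow_ne_zero 2 hk) _
  rw [NSf, RogersP, hW, hξ, ha, hb, hc, tsum_eq_sum (s := Finset.range (l + 1))]
  · ring
  · intro n hn
    rw [qpoch_inv_pow_eq_zero hqne (by simpa [Nat.lt_succ_iff] using hn)]
    simp
end

section
/- Let l ∈ ℕ, let q ∈ ℂ∖{0} with a fixed square root q^{1/2}, with qᵐ ≠ 1 for 1 ≤ m ≤ l, and let k ∈ ℂ∖{0} with k² ≠ qᵐ for all integers m with 1 − l ≤ m ≤ 0. Then for every x ∈ ℂ∖{0} with x² ≠ 1: ((k − k⁻¹x⁻²)/(1 − x⁻²)) P_l(q^{1/2}x) + ((k⁻¹ − kx⁻²)/(1 − x⁻²)) P_l(q^{−1/2}x) = (k q^{l/2} + k⁻¹ q^{−l/2}) P_l(x). -/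
/-- The coefficient of `(x⁻²)ⁿ` in `x⁻ˡ P_l(x)`. -/
noncomputable def rogersCoeff (q k : ℂ) (l n : ℕ) : ℂ :=
  (qpoch (k ^ 2) q n * qpoch ((q⁻¹) ^ l) q n) /
    (qpoch q q n * qpoch ((k ^ 2)⁻¹ * q * (q⁻¹) ^ l) q n) * (q / k ^ 2) ^ n

lemma qpoch_succ (a q : ℂ) (n : ℕ) : qpoch a q (n + 1) = qpoch a q n * (1 - a * q ^ n) :=
  Finset.prod_range_succ _ _

lemma RogersP_eq_sum_rogersCoeff (q k : ℂ) (l : ℕ) (x : ℂ) :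
    RogersP q k l x =
      x ^ l * ∑ n ∈ Finset.range (l + 1), rogersCoeff q k l n * ((x⁻¹) ^ 2) ^ n := by
  unfold RogersP rogersCoeff
  congr 1
  refine Finset.sum_congr rfl fun n _ => ?_
  rw [mul_assoc _ ((q / k ^ 2) ^ n), ← mul_pow (q / k ^ 2), inv_pow x 2, ← div_eq_mul_inv (q / k ^ 2),
    div_div]

/-- The two-term recursion of the coefficients, for any `Q` with `Q² = qˡ`. -/
lemma rogersCoeff_succ {q k Q : ℂ} {l n : ℕ} (hq0 : q ≠ 0) (hk : k ≠ 0) (hQ : Q ^ 2 = q ^ l)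
    (hqn : q ^ (n + 1) ≠ 1) (hkn : k ^ 2 * q ^ l ≠ q ^ (n + 1)) :
    rogersCoeff q k l (n + 1) *
        (((q ^ (n + 1))⁻¹ - 1) * (k * Q - k⁻¹ * Q⁻¹ * q ^ (n + 1))) =
      rogersCoeff q k l n *
        (k⁻¹ * Q * (q ^ n)⁻¹ * (1 - k ^ 2 * q ^ n) * (1 - (q⁻¹) ^ l * q ^ n)) := by
  have hl0 : q ^ l ≠ 0 := pow_ne_zero _ hq0
  have hQ0 : Q ≠ 0 := by
    rintro rfl
    exact hl0 (by rw [← hQ]; ring)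
  have h1 : 1 - q ^ n * q ≠ 0 := by
    rw [← pow_succ]
    exact sub_ne_zero.2 hqn.symm
  have h2 : k ^ 2 * Q ^ 2 - q ^ n * q ≠ 0 := by
    rw [← pow_succ, hQ]
    exact sub_ne_zero.2 hkn
  have h3 : 1 - (k ^ 2)⁻¹ * q * (q⁻¹) ^ l * q ^ n =
      (k ^ 2 * Q ^ 2 - q ^ n * q) / (k ^ 2 * Q ^ 2) := by
    rw [inv_pow, ← hQ]
    field_simp
  have step : rogersCoeff q k l (n + 1) = rogersCoeff q k l n *
      ((1 - k ^ 2 * q ^ n) * (1 - (q⁻¹) ^ l * q ^ n) /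
        ((1 - q ^ n * q) * (1 - (k ^ 2)⁻¹ * q * (q⁻¹) ^ l * q ^ n)) * (q / k ^ 2)) := by
    simp only [rogersCoeff, qpoch_succ, pow_succ (q / k ^ 2), mul_div_mul_comm]
    ring
  have hn0 : q ^ n ≠ 0 := pow_ne_zero _ hq0
  rw [step, h3, mul_assoc, inv_pow, ← hQ, pow_succ q n]
  congr 1
  generalize q ^ n = t at *
  field_simp

/-- The partial sums of the eigenvalue equation telescope. -/
lemma sum_rogersCoeff_telescope {q k Q : ℂ} {l : ℕ} (hq0 : q ≠ 0) (hk : k ≠ 0)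
    (hQ : Q ^ 2 = q ^ l) (hq : ∀ m : ℕ, 1 ≤ m → m ≤ l → q ^ m ≠ 1)
    (hkq : ∀ m : ℕ, 1 ≤ m → m ≤ l → k ^ 2 * q ^ l ≠ q ^ m) (y : ℂ) (N : ℕ) (hN : N ≤ l) :
    ∑ n ∈ Finset.range (N + 1), rogersCoeff q k l n * y ^ n *
        (((q ^ n)⁻¹ - 1) * (k * Q - k⁻¹ * Q⁻¹ * q ^ n) -
          k⁻¹ * Q * (q ^ n)⁻¹ * (1 - k ^ 2 * q ^ n) * (1 - (q⁻¹) ^ l * q ^ n) * y) =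
      -(rogersCoeff q k l N *
        (k⁻¹ * Q * (q ^ N)⁻¹ * (1 - k ^ 2 * q ^ N) * (1 - (q⁻¹) ^ l * q ^ N)) * y ^ (N + 1)) := by
  induction N with
  | zero =>
    simp
    ring
  | succ N ih =>
    rw [Finset.sum_range_succ, ih (by omega)]
    have := rogersCoeff_succ hq0 hk hQ (hq (N + 1) (by omega) hN) (hkq (N + 1) (by omega) hN)
    linear_combination y ^ (N + 1) * this

/-- The Rogers polynomial is an eigenfunction of the Macdonald–Ruijsenaars
`q`-difference operator of type `A₁` with eigenvalue `k q^{l/2} + k⁻¹ q^{-l/2}`;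
here `qh = q^{1/2}` is the fixed square root and `q = qh²`. -/
theorem stmt_13 (qh k : ℂ) (hqh : qh ≠ 0) (hk : k ≠ 0) (l : ℕ)
    (hq : ∀ m : ℕ, 1 ≤ m → m ≤ l → (qh ^ 2) ^ m ≠ 1)
    (hk2 : ∀ m : ℤ, 1 - (l : ℤ) ≤ m → m ≤ 0 → k ^ 2 ≠ (qh ^ 2) ^ m)
    (x : ℂ) (hx : x ≠ 0) (hx1 : x ^ 2 ≠ 1) :
    ((k - k⁻¹ * (x⁻¹) ^ 2) / (1 - (x⁻¹) ^ 2)) * RogersP (qh ^ 2) k l (qh * x)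
      + ((k⁻¹ - k * (x⁻¹) ^ 2) / (1 - (x⁻¹) ^ 2)) * RogersP (qh ^ 2) k l (qh⁻¹ * x)
      = (k * qh ^ l + k⁻¹ * (qh⁻¹) ^ l) * RogersP (qh ^ 2) k l x := by
  have hq0 : qh ^ 2 ≠ 0 := pow_ne_zero _ hqh
  have hkq : ∀ m : ℕ, 1 ≤ m → m ≤ l → k ^ 2 * (qh ^ 2) ^ l ≠ (qh ^ 2) ^ m := by
    intro m hm1 hml h
    refine hk2 ((m : ℤ) - l) (by omega) (by omega) ?_
    rw [zpow_sub₀ hq0, zpow_natCast, zpow_natCast, ← h, mul_div_cancel_right₀ _ (pow_ne_zero _ hq0)]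
  have hQ : (qh ^ l) ^ 2 = (qh ^ 2) ^ l := pow_right_comm _ _ _
  have htel := sum_rogersCoeff_telescope hq0 hk hQ hq hkq ((x⁻¹) ^ 2) l le_rfl
  have hlast : 1 - ((qh ^ 2)⁻¹) ^ l * (qh ^ 2) ^ l = 0 := by
    rw [← mul_pow, inv_mul_cancel₀ hq0, one_pow, sub_self]
  rw [hlast, mul_zero, mul_zero, zero_mul, neg_zero] at htel
  have hy : 1 - (x⁻¹) ^ 2 ≠ 0 := by
    rw [inv_pow, sub_ne_zero]
    exact fun h => hx1 (inv_eq_one.1 h.symm)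
  have hQ0 : qh ^ l ≠ 0 := pow_ne_zero _ hqh
  have hup : ∀ n, ((qh * x)⁻¹ ^ 2) ^ n = ((qh ^ 2) ^ n)⁻¹ * ((x⁻¹) ^ 2) ^ n := fun n => by
    rw [mul_inv, mul_pow, mul_pow, inv_pow, inv_pow]
  have hdown : ∀ n, ((qh⁻¹ * x)⁻¹ ^ 2) ^ n = (qh ^ 2) ^ n * ((x⁻¹) ^ 2) ^ n := fun n => by
    rw [mul_inv, inv_inv, mul_pow, mul_pow]
  simp only [RogersP_eq_sum_rogersCoeff, hup, hdown, mul_pow _ x l, inv_pow qh]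
  generalize (x⁻¹) ^ 2 = y at *
  rw [div_mul_eq_mul_div, div_mul_eq_mul_div, ← add_div, div_eq_iff hy, ← sub_eq_zero,
    ← mul_zero (x ^ l), ← htel]
  simp only [Finset.mul_sum, Finset.sum_mul, ← Finset.sum_add_distrib, ← Finset.sum_sub_distrib]
  refine Finset.sum_congr rfl fun n _ => ?_
  have hn0 : (qh ^ 2) ^ n ≠ 0 := pow_ne_zero _ hq0
  rw [inv_pow, ← hQ]
  generalize (qh ^ 2) ^ n = t at *
  generalize qh ^ l = Q at *
  field_simp
  ring
end

section
/- Let l ∈ ℕ, let q ∈ ℂ∖{0} with qᵐ ≠ 1 for 1 ≤ m ≤ l, and let k ∈ ℂ∖{0} with k² ≠ qᵐ for every integer m. Then for every x ∈ ℂ∖{0}: x^l Σ_{n=0}^{l} ((k²;q)_n (q^{−l};q)_n)/((q;q)_n (k⁻²q^{1−l};q)_n) (q/(k²x²))ⁿ = ((q;q)_l/(k²;q)_l) Σ_{i=0}^{l} ((k²;q)_i (k²;q)_{l−i})/((q;q)_i (q;q)_{l−i}) x^{2i−l}. In particular P_l(x⁻¹) = P_l(x), i.e. P_l is a W₀-invariant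 Laurent polynomial. -/
lemma qpoch_ne_zero {a q : ℂ} {n : ℕ} (h : ∀ j < n, a * q ^ j ≠ 1) : qpoch a q n ≠ 0 :=
  Finset.prod_ne_zero_iff.mpr fun j hj =>
    sub_ne_zero.mpr (h j (Finset.mem_range.mp hj)).symm

/-- Reversing the order of the last `n` factors of `(t;q)_{m+n}`. -/
lemma qpoch_reverse {q t : ℂ} (hq : q ≠ 0) (ht : t ≠ 0) (n m : ℕ) :
    qpoch (t⁻¹ * q * q⁻¹ ^ (m + n)) q n * qpoch t q m *
      (t ^ n * ∏ j ∈ Finset.range n, -(q ^ (m + n) * q⁻¹ ^ (j + 1))) = qpoch t q (m + n) := by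
  induction n generalizing m with
  | zero => simp [qpoch]
  | succ n ih =>
    have h := ih (m + 1)
    rw [show m + 1 + n = m + (n + 1) by ring] at h
    rw [← h, qpoch_succ _ _ n, qpoch_succ _ _ m, Finset.prod_range_succ]
    have key : (1 - t⁻¹ * q * q⁻¹ ^ (m + (n + 1)) * q ^ n) *
        (t * -(q ^ (m + (n + 1)) * q⁻¹ ^ (n + 1))) = 1 - t * q ^ m := by
      simp only [inv_pow]
      field_simp
      ring
    rw [← key]
    ring

/-- The expansion of the Rogers polynomial in the powers `x ^ (l - 2 * i)`. -/
lemma RogersP_eq_sum {q k : ℂ} (hq : q ≠ 0) (hk : k ≠ 0) {l : ℕ}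
    (hq1 : ∀ m : ℕ, 1 ≤ m → m ≤ l → q ^ m ≠ 1) (hk2 : ∀ m : ℤ, k ^ 2 ≠ q ^ m)
    {x : ℂ} (hx : x ≠ 0) :
    RogersP q k l x = (qpoch q q l / qpoch (k ^ 2) q l) *
      ∑ i ∈ Finset.range (l + 1),
        (qpoch (k ^ 2) q i * qpoch (k ^ 2) q (l - i)) /
          (qpoch q q i * qpoch q q (l - i)) * x ^ ((l : ℤ) - 2 * (i : ℤ)) := by
  have hqq : ∀ n ≤ l, qpoch q q n ≠ 0 := fun n hn =>
    qpoch_ne_zero fun j hj => by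
      rw [← pow_succ']
      exact hq1 (j + 1) (by omega) (by omega)
  have hkq : ∀ n, qpoch (k ^ 2) q n ≠ 0 := fun n =>
    qpoch_ne_zero fun j _ h => hk2 (-j) (by
      rw [zpow_neg, zpow_natCast]
      exact eq_inv_of_mul_eq_one_left h)
  have hk0 : k ^ 2 ≠ 0 := pow_ne_zero 2 hk
  unfold RogersP
  rw [Finset.mul_sum, Finset.mul_sum]
  refine Finset.sum_congr rfl fun n hn => ?_
  obtain ⟨m, rfl⟩ : ∃ m, l = m + n := ⟨l - n, by have := Finset.mem_range.mp hn; omega⟩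
  have h1 := qpoch_reverse hq hq n m
  have h2 := qpoch_reverse hq hk0 n m
  rw [inv_mul_cancel₀ hq, one_mul] at h1
  have hB := hkq (m + n)
  rw [← h2] at hB
  have hx' : x ^ (((m + n : ℕ) : ℤ) - 2 * (n : ℤ)) = x ^ (m + n) / (x ^ 2) ^ n := by
    rw [zpow_sub₀ hx, zpow_natCast, ← pow_mul]
    norm_cast
  rw [hx', Nat.add_sub_cancel, ← h1, ← h2, div_pow, mul_pow]
  have hn0 := hqq n (by omega)
  have hm0 := hqq m (by omega)
  have hkm := hkq m
  generalize ∏ j ∈ Finset.range n, -(q ^ (m + n) * q⁻¹ ^ (j + 1)) = c at *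
  have hc : c ≠ 0 := right_ne_zero_of_mul (right_ne_zero_of_mul hB)
  have hD : qpoch ((k ^ 2)⁻¹ * q * q⁻¹ ^ (m + n)) q n ≠ 0 :=
    left_ne_zero_of_mul (left_ne_zero_of_mul hB)
  generalize qpoch ((k ^ 2)⁻¹ * q * q⁻¹ ^ (m + n)) q n = D at *
  generalize qpoch (q⁻¹ ^ (m + n)) q n = E at *
  generalize qpoch (k ^ 2) q m = F at *
  generalize qpoch (k ^ 2) q n = G at *
  generalize qpoch q q n = H at *
  generalize qpoch q q m = I at *
  field_simp

/-- Reversing the summation in Macdonald's symmetric sum. -/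
lemma sum_symm_zpow_reflect (f g : ℕ → ℂ) (l : ℕ) (x : ℂ) :
    ∑ i ∈ Finset.range (l + 1),
        (f i * f (l - i)) / (g i * g (l - i)) * x ^ ((l : ℤ) - 2 * (i : ℤ)) =
      ∑ i ∈ Finset.range (l + 1),
        (f i * f (l - i)) / (g i * g (l - i)) * x ^ (2 * (i : ℤ) - (l : ℤ)) := by
  rw [← Finset.sum_range_reflect]
  refine Finset.sum_congr rfl fun i hi => ?_
  have hi' : i ≤ l := Nat.lt_succ_iff.mp (Finset.mem_range.mp hi)
  rw [show l + 1 - 1 - i = l - i by omega, Nat.sub_sub_self hi', mul_comm (f (l - i)),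
    mul_comm (g (l - i)), show (l : ℤ) - 2 * ((l - i : ℕ) : ℤ) = 2 * (i : ℤ) - l by omega]

/-- Macdonald's symmetric expansion of the Rogers polynomial of type `A₁`;
in particular `P_l(x⁻¹) = P_l(x)`. -/
theorem stmt_14 (q k : ℂ) (hq : q ≠ 0) (hk : k ≠ 0) (l : ℕ)
    (hq1 : ∀ m : ℕ, 1 ≤ m → m ≤ l → q ^ m ≠ 1)
    (hk2 : ∀ m : ℤ, k ^ 2 ≠ q ^ m)
    (x : ℂ) (hx : x ≠ 0) :
    (RogersP q k l x
      = (qpoch q q l / qpoch (k ^ 2) q l) *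
        ∑ i ∈ Finset.range (l + 1),
          (qpoch (k ^ 2) q i * qpoch (k ^ 2) q (l - i)) /
            (qpoch q q i * qpoch q q (l - i)) * x ^ (2 * (i : ℤ) - (l : ℤ))) ∧
    RogersP q k l x⁻¹ = RogersP q k l x := by
  have h := RogersP_eq_sum hq hk hq1 hk2 hx
  rw [sum_symm_zpow_reflect] at h
  refine ⟨h, ?_⟩
  rw [h, RogersP_eq_sum hq hk hq1 hk2 (inv_ne_zero hx)]
  simp only [inv_zpow', neg_sub]
end
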